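/- Let a, b ≥ 1 be natural numbers with a ≠ b and set P(x₁,x₂) = x₁^a − x₂^b. There do not exist absolutely continuous functions x = (x₁,x₂,x₃) : [0,1] → ℝ³ and p = (p₁,p₂,p₃) : [0,1] → ℝ³ such that: (a) x is nonconstant; (b) x₁(t)^a = x₂(t)^b and x₃(t) = 0 for all t ∈ [0,1] (i.e. x is supported on the abnormal curve {P = 0, x₃ = 0}); and (c) with h(t) := p₂(t) + p₃(t)·P(x₁(t),x₂(t))², the pair (x,p) solves the normal Hamiltonian system x₁' = p₁, x₂' = h, x₃' = h·P(x₁,x₂)², p₁' = −h·p₃·∂_{x₁}(P²)(x₁,x₂) = −h·p₃·2a x₁^{a−1}P(x₁,x₂), p₂' = −h·p₃·∂_{x₂}(P²)(x₁,x₂) = h·p₃·2b x₂^{b−1}P(x₁,x₂), p₃' = 0, a.e. on [0,1]. In particular, no parameterization of the curve γ_ε is a normal extremal, so γ_ε is strictly abnormal when a ≠ b. -/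

import Mathlib

open MeasureTheory Set

/-- The `n`-th power of an affine polynomial of nonzero slope has degree `n`. -/
theorem natDegree_affine_pow_eq (u c : ℝ) (n : ℕ) :
    ((Polynomial.C u * Polynomial.X + Polynomial.C c) ^ n).natDegree = if u = 0 then 0 else n := by
  split_ifs with hu
  · simp [hu]
  · rw [Polynomial.natDegree_pow, Polynomial.natDegree_linear hu, mul_one]

/-- Powers of two affine functions with distinct positive exponents agree on `[0, 1]` only if both
functions are constant. -/
theorem slopes_eq_zero_of_affine_pow_eq {a b : ℕ} (ha : 1 ≤ a) (hb : 1 ≤ b) (hab : a ≠ b)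
    {u c v d : ℝ} (h : ∀ t ∈ Icc (0 : ℝ) 1, (u * t + c) ^ a = (v * t + d) ^ b) :
    u = 0 ∧ v = 0 := by
  have hpoly : (Polynomial.C u * Polynomial.X + Polynomial.C c) ^ a =
      (Polynomial.C v * Polynomial.X + Polynomial.C d) ^ b :=
    Polynomial.eq_of_infinite_eval_eq _ _ <|
      (Icc_infinite (zero_lt_one' ℝ)).mono fun t ht => by simpa using h t ht
  have hdeg := congrArg Polynomial.natDegree hpoly
  rw [natDegree_affine_pow_eq, natDegree_affine_pow_eq] at hdeg
  split_ifs at hdeg <;> first | omega | tauto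

/-- A function satisfying an integral equation on `[0, 1]` whose integrand is constant there
is affine on `[0, 1]`. -/
theorem eq_affine_of_integral_eq {x f : ℝ → ℝ} {k : ℝ}
    (hx : ∀ t ∈ Icc (0 : ℝ) 1, x t = x 0 + ∫ s in (0 : ℝ)..t, f s)
    (hf : ∀ t ∈ Icc (0 : ℝ) 1, f t = k) :
    ∀ t ∈ Icc (0 : ℝ) 1, x t = k * t + x 0 := by
  intro t ht
  have hint : ∫ s in (0 : ℝ)..t, f s = ∫ _ in (0 : ℝ)..t, k :=
    intervalIntegral.integral_congr fun s hs => by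
      rw [uIcc_of_le ht.1] at hs
      exact hf s ⟨hs.1, hs.2.trans ht.2⟩
  rw [hx t ht, hint, intervalIntegral.integral_const, smul_eq_mul]
  ring

/-- Lemma 2.11 of the paper. For `a ≠ b`, there is no nonconstant solution
`(x, p)` of the normal Hamiltonian system of the sub-Riemannian structure generated by
`P(x₁,x₂) = x₁^a − x₂^b` that is supported on the abnormal set `{x₁^a = x₂^b, x₃ = 0}`.
In particular, no parameterization of `γ_ε` is a normal extremal, so `γ_ε` is strictly abnormal.
The absolutely continuous solution and its covector are encoded by continuous functions
satisfying the integral form of the Hamiltonian equations, where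
`h(t) = p₂(t) + p₃(t)·P(x₁(t),x₂(t))²`. -/
theorem no_normal_parameterization (a b : ℕ) (ha : 1 ≤ a) (hb : 1 ≤ b) (hab : a ≠ b) :
    ¬ ∃ x1 x2 x3 p1 p2 p3 : ℝ → ℝ,
      ContinuousOn x1 (Icc (0:ℝ) 1) ∧ ContinuousOn x2 (Icc (0:ℝ) 1) ∧
      ContinuousOn x3 (Icc (0:ℝ) 1) ∧ ContinuousOn p1 (Icc (0:ℝ) 1) ∧
      ContinuousOn p2 (Icc (0:ℝ) 1) ∧ ContinuousOn p3 (Icc (0:ℝ) 1) ∧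
      -- (a) `x` is nonconstant
      (∃ t ∈ Icc (0:ℝ) 1, (x1 t, x2 t, x3 t) ≠ (x1 0, x2 0, x3 0)) ∧
      -- (b) `x` is supported on the abnormal curve `{P = 0, x₃ = 0}`
      (∀ t ∈ Icc (0:ℝ) 1, (x1 t) ^ a = (x2 t) ^ b ∧ x3 t = 0) ∧
      -- (c) `(x,p)` solves the normal Hamiltonian system (in integral form)
      (∀ t ∈ Icc (0:ℝ) 1, x1 t = x1 0 + ∫ s in (0:ℝ)..t, p1 s) ∧
      (∀ t ∈ Icc (0:ℝ) 1, x2 t = x2 0 + ∫ s in (0:ℝ)..t,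
          (p2 s + p3 s * ((x1 s) ^ a - (x2 s) ^ b) ^ 2)) ∧
      (∀ t ∈ Icc (0:ℝ) 1, x3 t = x3 0 + ∫ s in (0:ℝ)..t,
          (p2 s + p3 s * ((x1 s) ^ a - (x2 s) ^ b) ^ 2) * ((x1 s) ^ a - (x2 s) ^ b) ^ 2) ∧
      (∀ t ∈ Icc (0:ℝ) 1, p1 t = p1 0 + ∫ s in (0:ℝ)..t,
          -((p2 s + p3 s * ((x1 s) ^ a - (x2 s) ^ b) ^ 2) * p3 s *
            (2 * a * (x1 s) ^ (a - 1) * ((x1 s) ^ a - (x2 s) ^ b)))) ∧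
      (∀ t ∈ Icc (0:ℝ) 1, p2 t = p2 0 + ∫ s in (0:ℝ)..t,
          (p2 s + p3 s * ((x1 s) ^ a - (x2 s) ^ b) ^ 2) * p3 s *
            (2 * b * (x2 s) ^ (b - 1) * ((x1 s) ^ a - (x2 s) ^ b))) ∧
      (∀ t ∈ Icc (0:ℝ) 1, p3 t = p3 0) := by
  rintro ⟨x1, x2, x3, p1, p2, p3, -, -, -, -, -, -, ⟨t, ht, hne⟩, hcurve, hx1, hx2, -, hp1, hp2, -⟩
  have hP : ∀ s ∈ Icc (0 : ℝ) 1, x1 s ^ a - x2 s ^ b = 0 := fun s hs =>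
    sub_eq_zero.mpr (hcurve s hs).1
  have hp1_const : ∀ s ∈ Icc (0 : ℝ) 1, p1 s = p1 0 := fun s hs => by
    simpa using eq_affine_of_integral_eq (k := 0) hp1 (fun r hr => by simp [hP r hr]) s hs
  have hp2_const : ∀ s ∈ Icc (0 : ℝ) 1, p2 s = p2 0 := fun s hs => by
    simpa using eq_affine_of_integral_eq (k := 0) hp2 (fun r hr => by simp [hP r hr]) s hs
  have hx1_affine := eq_affine_of_integral_eq hx1 hp1_const
  have hx2_affine := eq_affine_of_integral_eq (k := p2 0) hx2 fun s hs => by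
    simp [hP s hs, hp2_const s hs]
  obtain ⟨hu, hv⟩ := slopes_eq_zero_of_affine_pow_eq (u := p1 0) (v := p2 0) ha hb hab
    fun s hs => by rw [← hx1_affine s hs, ← hx2_affine s hs, (hcurve s hs).1]
  refine hne ?_
  rw [hx1_affine t ht, hx2_affine t ht, (hcurve t ht).2,
    (hcurve 0 (left_mem_Icc.mpr zero_le_one)).2, hu, hv]
  simp
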